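/- Every q-commuting pair of isometries (X1, X2) on a Hilbert space admits a q-commuting unitary extension (Y1, Y2) on a larger Hilbert space such that Y = Y1Y2 is the minimal unitary extension of X = X1X2. -/

import Mathlib

open ContinuousLinearMap

universe u

/-- A `q`-commuting unitary extension of a pair of operators `(X1, X2)` on a Hilbert
space `K`: a Hilbert space containing `K` (via a linear isometry `emb`), carrying a pair of
`q`-commuting unitaries `(Y1, Y2)` restricting to `(X1, X2)` on `K`, such that `Y = Y1 Y2`
is the *minimal* unitary extension of `X = X1 X2`, i.e. the whole space is generated by
`{Y*ⁿ (emb k) : k ∈ K, n ≥ 0}`. -/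
structure QCommUnitaryExtension (q : ℂ) (K : Type u) [NormedAddCommGroup K]
    [InnerProductSpace ℂ K] [CompleteSpace K] (X1 X2 : K →L[ℂ] K) : Type (u + 1) where
  carrier : Type u
  [nacg : NormedAddCommGroup carrier]
  [ips : InnerProductSpace ℂ carrier]
  [cs : CompleteSpace carrier]
  emb : K →ₗᵢ[ℂ] carrier
  Y1 : carrier →L[ℂ] carrier
  Y2 : carrier →L[ℂ] carrier
  unitary1 : adjoint Y1 ∘L Y1 = 1 ∧ Y1 ∘L adjoint Y1 = 1
  unitary2 : adjoint Y2 ∘L Y2 = 1 ∧ Y2 ∘L adjoint Y2 = 1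
  qcomm : Y1 ∘L Y2 = q • (Y2 ∘L Y1)
  ext1 : ∀ k : K, Y1 (emb k) = emb (X1 k)
  ext2 : ∀ k : K, Y2 (emb k) = emb (X2 k)
  minimal : (Submodule.span ℂ
      {x : carrier | ∃ (k : K) (n : ℕ),
        x = ((adjoint (Y1 ∘L Y2)) ^ n) (emb k)}).topologicalClosure = ⊤

section QCommHelpers

open Filter Topology

variable {K : Type u} [NormedAddCommGroup K] [InnerProductSpace ℂ K]

/-- Sequences that are eventually orbits of `X`. -/
def orbitSub (X : K →ₗᵢ[ℂ] K) : Submodule ℂ (ℕ → K) where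
  carrier := {u | ∀ᶠ m in atTop, u (m + 1) = X (u m)}
  zero_mem' := by simp
  add_mem' := by
    intro a b ha hb
    filter_upwards [ha, hb] with m h1 h2
    simp [h1, h2]
  smul_mem' := by
    intro c a ha
    filter_upwards [ha] with m h1
    simp [h1]

/-- The space of eventual orbits, as a plain type (no product topology). -/
def OrbitSpace (X : K →ₗᵢ[ℂ] K) : Type u := ↥(orbitSub X)

namespace OrbitSpace

variable {X : K →ₗᵢ[ℂ] K}

noncomputable instance : AddCommGroup (OrbitSpace X) :=
  inferInstanceAs (AddCommGroup ↥(orbitSub X))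

noncomputable instance : Module ℂ (OrbitSpace X) :=
  inferInstanceAs (Module ℂ ↥(orbitSub X))

/-- The underlying sequence. -/
def seq (u : OrbitSpace X) : ℕ → K := u.1

theorem seq_add (u v : OrbitSpace X) : (u + v).seq = u.seq + v.seq := rfl
theorem seq_sub (u v : OrbitSpace X) : (u - v).seq = u.seq - v.seq := rfl
theorem seq_smul (c : ℂ) (u : OrbitSpace X) : (c • u).seq = c • u.seq := rfl

theorem seq_prop (u : OrbitSpace X) : ∀ᶠ m in atTop, u.seq (m + 1) = X (u.seq m) := u.2

theorem ext_seq {u v : OrbitSpace X} (h : ∀ m, u.seq m = v.seq m) : u = v :=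
  Subtype.ext (funext h)

theorem exists_tendsto (u v : OrbitSpace X) :
    ∃ c : ℂ, Tendsto (fun m => inner ℂ (u.seq m) (v.seq m)) atTop (𝓝 c) := by
  obtain ⟨N, hN⟩ := eventually_atTop.1 (u.seq_prop.and v.seq_prop)
  refine ⟨inner ℂ (u.seq N) (v.seq N), ?_⟩
  apply tendsto_const_nhds.congr'
  filter_upwards [eventually_ge_atTop N] with m hm
  induction m, hm using Nat.le_induction with
  | base => rfl
  | succ m hm ih => rw [ih, (hN m hm).1, (hN m hm).2, X.inner_map_map]

/-- The limiting inner product. -/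
noncomputable def ip (u v : OrbitSpace X) : ℂ := (exists_tendsto u v).choose

theorem ip_tendsto (u v : OrbitSpace X) :
    Tendsto (fun m => inner ℂ (u.seq m) (v.seq m)) atTop (𝓝 (ip u v)) :=
  (exists_tendsto u v).choose_spec

noncomputable abbrev core (X : K →ₗᵢ[ℂ] K) : PreInnerProductSpace.Core ℂ (OrbitSpace X) where
  inner u v := ip u v
  conj_inner_symm u v := by
    refine tendsto_nhds_unique ?_ (ip_tendsto u v)
    have := (Complex.continuous_conj.tendsto _).comp (ip_tendsto v u)
    refine this.congr fun m => ?_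
    simp
  re_inner_nonneg u := by
    have := (Complex.continuous_re.tendsto _).comp (ip_tendsto u u)
    refine ge_of_tendsto' this fun m => ?_
    exact inner_self_nonneg (𝕜 := ℂ)
  add_left u v w := by
    refine tendsto_nhds_unique (ip_tendsto (u + v) w) ?_
    refine ((ip_tendsto u w).add (ip_tendsto v w)).congr fun m => ?_
    simp [seq_add, inner_add_left]
  smul_left u v r := by
    refine tendsto_nhds_unique (ip_tendsto (r • u) v) ?_
    refine ((ip_tendsto u v).const_mul _).congr fun m => ?_
    simp [seq_smul, mul_comm]

noncomputable instance : SeminormedAddCommGroup (OrbitSpace X) :=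
  InnerProductSpace.Core.toSeminormedAddCommGroup (c := core X)

noncomputable instance : InnerProductSpace ℂ (OrbitSpace X) :=
  InnerProductSpace.ofCore (core X)

theorem inner_def (u v : OrbitSpace X) : inner ℂ u v = ip u v := rfl

theorem norm_tendsto (u : OrbitSpace X) :
    Tendsto (fun m => ‖u.seq m‖) atTop (𝓝 ‖u‖) := by
  have h := (Complex.continuous_re.tendsto _).comp (ip_tendsto u u)
  have h2 := (Real.continuous_sqrt.tendsto _).comp h
  rw [← inner_def, show (inner ℂ u u).re = ‖u‖ ^ 2 from
    inner_self_eq_norm_sq (𝕜 := ℂ) u, Real.sqrt_sq (norm_nonneg u)] at h2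
  refine h2.congr fun m => ?_
  have : (inner ℂ (u.seq m) (u.seq m)).re = ‖u.seq m‖ ^ 2 :=
    inner_self_eq_norm_sq (𝕜 := ℂ) _
  simp only [Function.comp]
  rw [this, Real.sqrt_sq (norm_nonneg _)]

theorem norm_eq_of {u : OrbitSpace X} {c : ℝ} (h : ∀ᶠ m in atTop, ‖u.seq m‖ = c) : ‖u‖ = c :=
  tendsto_nhds_unique ((norm_tendsto u)) (tendsto_const_nhds.congr' (h.mono fun _ h => h.symm))

theorem coe_eq_of {u v : OrbitSpace X} (h : ∀ᶠ m in atTop, u.seq m = v.seq m) :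
    (u : UniformSpace.Completion (OrbitSpace X)) = v := by
  rw [← sub_eq_zero, ← UniformSpace.Completion.coe_sub, ← norm_eq_zero,
    UniformSpace.Completion.norm_coe]
  apply norm_eq_of
  filter_upwards [h] with m hm
  simp [seq_sub, hm]

/-- Pointwise operators. -/
noncomputable def opMap (T : ℕ → K →L[ℂ] K) (hT : ∀ m x, ‖T m x‖ = ‖x‖)
    (hc : ∀ m x, T (m + 1) (X x) = X (T m x)) : OrbitSpace X →ₗᵢ[ℂ] OrbitSpace X where
  toFun u := ⟨fun m => T m (u.seq m), by
    show ∀ᶠ m in atTop, _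
    filter_upwards [u.seq_prop] with m hm
    rw [hm, hc]⟩
  map_add' u v := by
    apply ext_seq
    intro m
    exact (T m).map_add _ _
  map_smul' c u := by
    apply ext_seq
    intro m
    exact (T m).map_smul _ _
  norm_map' u := by
    refine tendsto_nhds_unique (norm_tendsto _) ((norm_tendsto u).congr fun m => ?_)
    exact (hT m _).symm

theorem opMap_seq (T : ℕ → K →L[ℂ] K) (hT : ∀ m x, ‖T m x‖ = ‖x‖)
    (hc : ∀ m x, T (m + 1) (X x) = X (T m x)) (u : OrbitSpace X) (m : ℕ) :
    (opMap T hT hc u).seq m = T m (u.seq m) := rfl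

/-- Right shift. -/
noncomputable def shiftR : OrbitSpace X →ₗᵢ[ℂ] OrbitSpace X where
  toFun u := ⟨fun m => u.seq (m - 1), by
    show ∀ᶠ m in atTop, _
    obtain ⟨N, hN⟩ := eventually_atTop.1 u.seq_prop
    filter_upwards [eventually_ge_atTop (N + 1)] with m hm
    obtain ⟨k, rfl⟩ : ∃ k, m = k + 1 := ⟨m - 1, by omega⟩
    exact hN k (by omega)⟩
  map_add' u v := rfl
  map_smul' c u := rfl
  norm_map' u := by
    refine tendsto_nhds_unique (norm_tendsto _) ?_
    exact (norm_tendsto u).comp (tendsto_sub_atTop_nat 1)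

theorem shiftR_seq (u : OrbitSpace X) (m : ℕ) : (shiftR u).seq m = u.seq (m - 1) := rfl

/-- The orbit embedding. -/
noncomputable def orbit (X : K →ₗᵢ[ℂ] K) : K →ₗᵢ[ℂ] OrbitSpace X where
  toFun k := ⟨fun m => (X^[m]) k, by
    show ∀ᶠ m in atTop, _
    exact Eventually.of_forall fun m => Function.iterate_succ_apply' _ _ _⟩
  map_add' u v := by
    apply ext_seq
    intro m
    exact iterate_map_add X m u v
  map_smul' c u := by
    apply ext_seq
    intro m
    show X^[m] (c • u) = c • X^[m] u
    induction m with
    | zero => rfl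
    | succ m ih => rw [Function.iterate_succ_apply', ih, map_smul, Function.iterate_succ_apply']
  norm_map' u := by
    apply norm_eq_of
    refine Eventually.of_forall fun m => ?_
    show ‖X^[m] u‖ = ‖u‖
    induction m with
    | zero => rfl
    | succ m ih => rw [Function.iterate_succ_apply', X.norm_map, ih]

theorem orbit_seq (k : K) (m : ℕ) : (orbit X k).seq m = X^[m] k := rfl

end OrbitSpace

/-- Extension of an isometry to the completion. -/
noncomputable def complMap {V : Type u} [SeminormedAddCommGroup V] [InnerProductSpace ℂ V]
    (f : V →ₗᵢ[ℂ] V) : UniformSpace.Completion V →L[ℂ] UniformSpace.Completion V :=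
  f.toContinuousLinearMap.completion

theorem complMap_coe {V : Type u} [SeminormedAddCommGroup V] [InnerProductSpace ℂ V]
    (f : V →ₗᵢ[ℂ] V) (v : V) : complMap f (v : UniformSpace.Completion V) = (f v : V) := by
  simp [complMap]

theorem complMap_norm {V : Type u} [SeminormedAddCommGroup V] [InnerProductSpace ℂ V]
    (f : V →ₗᵢ[ℂ] V) (x : UniformSpace.Completion V) : ‖complMap f x‖ = ‖x‖ := by
  induction x using UniformSpace.Completion.induction_on with
  | hp => exact isClosed_eq (by fun_prop) (by fun_prop)
  | ih a => rw [complMap_coe]; simp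

theorem compl_ext {V : Type u} [SeminormedAddCommGroup V] [InnerProductSpace ℂ V]
    {f g : UniformSpace.Completion V →L[ℂ] UniformSpace.Completion V}
    (h : ∀ v : V, f (v : UniformSpace.Completion V) = g (v : UniformSpace.Completion V)) :
    f = g := by
  ext x
  induction x using UniformSpace.Completion.induction_on with
  | hp => exact isClosed_eq (by fun_prop) (by fun_prop)
  | ih a => exact h a

theorem unitary_of_isometry_right_inv {H : Type u} [NormedAddCommGroup H]
    [InnerProductSpace ℂ H] [CompleteSpace H] (U W : H →L[ℂ] H) (hU : ∀ x, ‖U x‖ = ‖x‖)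
    (hW : U ∘L W = 1) : adjoint U ∘L U = 1 ∧ U ∘L adjoint U = 1 := by
  have h1 : adjoint U ∘L U = 1 := (ContinuousLinearMap.norm_map_iff_adjoint_comp_self U).1 hU
  refine ⟨h1, ?_⟩
  have : adjoint U = W := by
    calc adjoint U = adjoint U ∘L (U ∘L W) := by rw [hW]; rfl
      _ = (adjoint U ∘L U) ∘L W := rfl
      _ = W := by rw [h1]; rfl
  rw [this, hW]

end QCommHelpers

/-- Every `q`-commuting pair of isometries `(X1, X2)` admits a `q`-commuting unitary
extension `(Y1, Y2)` such that `Y = Y1 Y2` is the minimal unitary extension of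
`X = X1 X2`. -/
theorem qcomm_isometric_pair_unitary_extension
    {K : Type u} [NormedAddCommGroup K] [InnerProductSpace ℂ K] [CompleteSpace K]
    (q : ℂ) (hq : ‖q‖ = 1)
    (X1 X2 : K →L[ℂ] K)
    (hX1 : ∀ x : K, ‖X1 x‖ = ‖x‖) (hX2 : ∀ x : K, ‖X2 x‖ = ‖x‖)
    (hcomm : X1 * X2 = q • (X2 * X1)) :
    Nonempty (QCommUnitaryExtension q K X1 X2) := by
  have hq0 : q ≠ 0 := by
    rintro rfl
    simp at hq
  have hc : ∀ x, X1 (X2 x) = q • X2 (X1 x) := fun x => congrArg (fun T => T x) hcomm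
  let X : K →ₗᵢ[ℂ] K := 
    { toLinearMap := (X1 ∘L X2).toLinearMap
      norm_map' := fun x => by simp [hX1, hX2] }
  have hX : ∀ x, X x = X1 (X2 x) := fun x => rfl
  have hqp : ∀ m : ℕ, ‖q ^ m‖ = 1 := fun m => by rw [norm_pow, hq, one_pow]
  let y1 : OrbitSpace X →ₗᵢ[ℂ] OrbitSpace X := OrbitSpace.opMap (fun m => (q ^ m)⁻¹ • X1)
    (fun m x => by simp [norm_smul, hq, hX1])
    (fun m x => by
      simp only [hX, ContinuousLinearMap.smul_apply, map_smul]
      rw [hc x, map_smul, smul_smul]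
      congr 1
      field_simp
      ring)
  let y2 : OrbitSpace X →ₗᵢ[ℂ] OrbitSpace X := OrbitSpace.opMap (fun m => q ^ m • X2)
    (fun m x => by simp [norm_smul, hq, hX2])
    (fun m x => by
      simp only [hX, ContinuousLinearMap.smul_apply, map_smul]
      rw [hc (X2 x), smul_smul, pow_succ])
  have s1 : ∀ u m, (y1 u).seq m = (q ^ m)⁻¹ • X1 (u.seq m) := fun u m => rfl
  have s2 : ∀ u m, (y2 u).seq m = q ^ m • X2 (u.seq m) := fun u m => rfl
  have s12 : ∀ u m, (y1 (y2 u)).seq m = X (u.seq m) := fun u m => by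
    have := pow_ne_zero m hq0
    rw [s1, s2, map_smul, smul_smul, inv_mul_cancel₀ this, one_smul, hX]
  let r : OrbitSpace X →ₗᵢ[ℂ] OrbitSpace X := OrbitSpace.shiftR
  have sr : ∀ u m, (r u).seq m = u.seq (m - 1) := fun u m => rfl
  have hqc : complMap y1 ∘L complMap y2 = q • (complMap y2 ∘L complMap y1) := by
    apply compl_ext
    intro v
    simp only [ContinuousLinearMap.comp_apply, ContinuousLinearMap.smul_apply, complMap_coe,
      ← UniformSpace.Completion.coe_smul]
    congr 1
    apply OrbitSpace.ext_seq
    intro m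
    have := pow_ne_zero m hq0
    rw [s12, OrbitSpace.seq_smul, Pi.smul_apply, s2, s1, map_smul,
      smul_smul (q ^ m), mul_inv_cancel₀ this, one_smul, hX, hc]
  have hYR : complMap y1 ∘L (complMap y2 ∘L complMap r) = 1 := by
    apply compl_ext
    intro v
    simp only [ContinuousLinearMap.comp_apply, complMap_coe, ContinuousLinearMap.one_apply]
    apply OrbitSpace.coe_eq_of
    obtain ⟨N, hN⟩ := Filter.eventually_atTop.1 v.seq_prop
    filter_upwards [Filter.eventually_ge_atTop (N + 1)] with m hm
    obtain ⟨k, rfl⟩ : ∃ k, m = k + 1 := ⟨m - 1, by omega⟩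
    rw [s12, sr, Nat.add_sub_cancel, hN k (by omega)]
  have hu1 := unitary_of_isometry_right_inv _ _ (complMap_norm y1) hYR
  have hYR2 : complMap y2 ∘L (q • (complMap y1 ∘L complMap r)) = 1 := by
    rw [ContinuousLinearMap.comp_smul, ← ContinuousLinearMap.comp_assoc,
      ← ContinuousLinearMap.smul_comp, ← hqc, ContinuousLinearMap.comp_assoc, hYR]
  have hu2 := unitary_of_isometry_right_inv _ _ (complMap_norm y2) hYR2
  have hY : ∀ x, adjoint (complMap y1 ∘L complMap y2) ((complMap y1 ∘L complMap y2) x) = x := by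
    have := (ContinuousLinearMap.norm_map_iff_adjoint_comp_self
      (complMap y1 ∘L complMap y2)).1 (fun x => by
        rw [ContinuousLinearMap.comp_apply, complMap_norm, complMap_norm])
    intro x
    exact congrArg (fun T => T x) this
  have hYn : ∀ n x, (adjoint (complMap y1 ∘L complMap y2) ^ n)
      (((complMap y1 ∘L complMap y2) ^ n) x) = x := by
    intro n
    induction n with
    | zero => intro x; rfl
    | succ n ih =>
      intro x
      rw [pow_succ, pow_succ', ContinuousLinearMap.mul_apply, ContinuousLinearMap.mul_apply, hY, ih]
  have hpow : ∀ n (u : OrbitSpace X), ∃ w : OrbitSpace X,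
      ((complMap y1 ∘L complMap y2) ^ n) (u : UniformSpace.Completion (OrbitSpace X)) = w ∧
      ∀ m, w.seq m = X^[n] (u.seq m) := by
    intro n u
    induction n with
    | zero => exact ⟨u, rfl, fun m => rfl⟩
    | succ n ih =>
      obtain ⟨w, h1, h2⟩ := ih
      refine ⟨y1 (y2 w), ?_, fun m => ?_⟩
      · rw [pow_succ', ContinuousLinearMap.mul_apply, h1, ContinuousLinearMap.comp_apply,
          complMap_coe, complMap_coe]
      · rw [s12, h2, Function.iterate_succ_apply']
  have hX1it : ∀ m k, (q ^ m)⁻¹ • X1 (X^[m] k) = X^[m] (X1 k) := by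
    intro m
    induction m with
    | zero => intro k; simp
    | succ m ih =>
      intro k
      rw [Function.iterate_succ_apply, Function.iterate_succ_apply, pow_succ', mul_inv, mul_smul,
        ih, ← LinearIsometry.coe_pow, ← map_smul, hX, hX, hc k, map_smul, map_smul, map_smul, smul_smul,
        inv_mul_cancel₀ hq0, one_smul]
  have hX2it : ∀ m k, q ^ m • X2 (X^[m] k) = X^[m] (X2 k) := by
    intro m
    induction m with
    | zero => intro k; simp
    | succ m ih =>
      intro k
      rw [Function.iterate_succ_apply, Function.iterate_succ_apply, pow_succ', mul_smul,
        ih, ← LinearIsometry.coe_pow, ← map_smul, hX, hX, hc (X2 k)]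
  refine ⟨{
    carrier := UniformSpace.Completion (OrbitSpace X)
    emb := UniformSpace.Completion.toComplₗᵢ.comp (OrbitSpace.orbit X)
    Y1 := complMap y1
    Y2 := complMap y2
    unitary1 := hu1
    unitary2 := hu2
    qcomm := hqc
    ext1 := ?_
    ext2 := ?_
    minimal := ?_ }⟩
  · intro k
    show complMap y1 ((OrbitSpace.orbit X k : OrbitSpace X) : UniformSpace.Completion _) =
      ((OrbitSpace.orbit X (X1 k) : OrbitSpace X) : UniformSpace.Completion _)
    rw [complMap_coe]
    congr 1
    apply OrbitSpace.ext_seq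
    intro m
    rw [s1, OrbitSpace.orbit_seq, OrbitSpace.orbit_seq, hX1it]
  · intro k
    show complMap y2 ((OrbitSpace.orbit X k : OrbitSpace X) : UniformSpace.Completion _) =
      ((OrbitSpace.orbit X (X2 k) : OrbitSpace X) : UniformSpace.Completion _)
    rw [complMap_coe]
    congr 1
    apply OrbitSpace.ext_seq
    intro m
    rw [s2, OrbitSpace.orbit_seq, OrbitSpace.orbit_seq, hX2it]
  · rw [← Submodule.dense_iff_topologicalClosure_eq_top]
    refine Dense.mono ?_ (UniformSpace.Completion.denseRange_coe (α := OrbitSpace X))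
    rintro _ ⟨u, rfl⟩
    apply Submodule.subset_span
    obtain ⟨N, hN⟩ := Filter.eventually_atTop.1 u.seq_prop
    refine ⟨u.seq N, N, ?_⟩
    show _ = (adjoint (complMap y1 ∘L complMap y2) ^ N)
      ((OrbitSpace.orbit X (u.seq N) : OrbitSpace X) : UniformSpace.Completion _)
    obtain ⟨w, h1, h2⟩ := hpow N u
    have : ((OrbitSpace.orbit X (u.seq N) : OrbitSpace X) :
        UniformSpace.Completion (OrbitSpace X)) = w := by
      apply OrbitSpace.coe_eq_of
      have key : ∀ m, N ≤ m → X^[N] (u.seq m) = X^[m] (u.seq N) := by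
        intro m hm
        induction m, hm using Nat.le_induction with
        | base => rfl
        | succ m hm ih =>
          rw [hN m hm, ← Function.iterate_succ_apply, Function.iterate_succ_apply', ih,
            Function.iterate_succ_apply']
      filter_upwards [Filter.eventually_ge_atTop N] with m hm
      rw [OrbitSpace.orbit_seq, h2, key m hm]
    rw [this, ← h1, hYn]
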